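/- arXiv:math/0110130 — 2 statements merged into one kernel-verified Lean document; each statement's English description precedes it below -/
import Mathlib

section
/- Let 𝔫 be a finite-dimensional real Lie algebra whose center is one-dimensional, spanned by a nonzero element Z. Let 𝔰 be an abelian Lie ideal of 𝔫 containing Z such that ⁅X, Y⁆ ∈ ℝ·Z for all X ∈ 𝔫 and Y ∈ 𝔰, and suppose dim 𝔰 = n + 1. Then there exist elements Y₁, …, Yₙ ∈ 𝔰 and X₁, …, Xₙ ∈ 𝔫 such that {Y₁, …, Yₙ, Z} is a basis of 𝔰, ⁅Xᵢ, Yᵢ⁆ = Z for all 1 ≤ i ≤ n, and ⁅Xᵢ, Yⱼ⁆ = 0 for all i ≠ j. -/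
/-- If a bilinear pairing is nondegenerate on the right, every basis of the (finite-dimensional)
right factor has a dual family in the left factor. -/
theorem LinearMap.exists_dual_family_of_flip_injective {K M V ι : Type*} [Field K]
    [AddCommGroup M] [Module K M] [AddCommGroup V] [Module K V] [FiniteDimensional K V]
    [DecidableEq ι] {B : M →ₗ[K] V →ₗ[K] K} (hB : Function.Injective B.flip)
    (b : Module.Basis ι K V) :
    ∃ x : ι → M, ∀ i j, B (x i) (b j) = if i = j then 1 else 0 := by
  choose x hx using fun i => LinearMap.flip_injective_iff₂.mp hB (b.coord i)
  exact ⟨x, fun i j => by simp [hx, Finsupp.single_apply, eq_comm]⟩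


/-- Let `𝔫` be a finite-dimensional real Lie algebra whose center is
one-dimensional, spanned by `Z ≠ 0`.  Let `𝔰` be an abelian Lie ideal of `𝔫` containing
`Z` with `⁅X, Y⁆ ∈ ℝ·Z` for all `X ∈ 𝔫`, `Y ∈ 𝔰`, and suppose `dim 𝔰 = n + 1`.  Then
there are `Y₁, …, Yₙ ∈ 𝔰` and `X₁, …, Xₙ ∈ 𝔫` such that `{Z, Y₁, …, Yₙ}` is a basis of
`𝔰`, `⁅Xᵢ, Yᵢ⁆ = Z` and `⁅Xᵢ, Yⱼ⁆ = 0` for `i ≠ j`. -/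
theorem schmidt_orthogonalization_heisenberg
    {𝔫 : Type*} [LieRing 𝔫] [LieAlgebra ℝ 𝔫] [FiniteDimensional ℝ 𝔫]
    (Z : 𝔫) (hZ : Z ≠ 0)
    (hcenter : (LieAlgebra.center ℝ 𝔫).toSubmodule = Submodule.span ℝ {Z})
    (𝔰 : LieIdeal ℝ 𝔫)
    (habel : ∀ Y ∈ 𝔰, ∀ Y' ∈ 𝔰, ⁅Y, Y'⁆ = (0 : 𝔫))
    (hZmem : Z ∈ 𝔰)
    (hbrk : ∀ X : 𝔫, ∀ Y ∈ 𝔰, ∃ r : ℝ, ⁅X, Y⁆ = r • Z)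
    (n : ℕ) (hdim : Module.finrank ℝ 𝔰 = n + 1) :
    ∃ (Y X : Fin n → 𝔫),
      (∀ i, Y i ∈ 𝔰) ∧
      LinearIndependent ℝ (Fin.cons Z Y : Fin (n + 1) → 𝔫) ∧
      Submodule.span ℝ (Set.range (Fin.cons Z Y : Fin (n + 1) → 𝔫)) = 𝔰.toSubmodule ∧
      (∀ i, ⁅X i, Y i⁆ = Z) ∧
      (∀ i j, i ≠ j → ⁅X i, Y j⁆ = (0 : 𝔫)) := by
  let z : 𝔰.toSubmodule := ⟨Z, hZmem⟩
  have hz : z ≠ 0 := fun h => hZ (congrArg Subtype.val h)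
  obtain ⟨φ, hφ⟩ := Module.Projective.exists_dual_eq_one ℝ hZ
  have hlie (X : 𝔫) {Y : 𝔫} (hY : Y ∈ 𝔰) : ⁅X, Y⁆ = φ ⁅X, Y⁆ • Z := by
    obtain ⟨r, hr⟩ := hbrk X Y hY
    simp [hr, hφ]
  obtain ⟨C, hC⟩ := Submodule.exists_isCompl (Submodule.span ℝ {z})
  have hCdim : Module.finrank ℝ C = n := by
    have h := Submodule.finrank_add_eq_of_isCompl hC
    rw [finrank_span_singleton hz] at h
    have hdim' : Module.finrank ℝ 𝔰.toSubmodule = n + 1 := hdim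
    omega
  let b := Module.finBasisOfFinrankEq ℝ C hCdim
  let ι : C →ₗ[ℝ] 𝔫 := 𝔰.toSubmodule.subtype ∘ₗ C.subtype
  let B : 𝔫 →ₗ[ℝ] C →ₗ[ℝ] ℝ :=
    ((LieModule.toEnd ℝ 𝔫 𝔫 : 𝔫 →ₗ[ℝ] Module.End ℝ 𝔫).compl₂ ι).compr₂ φ
  have hmem (c : C) : ι c ∈ 𝔰 := c.1.2
  have hBlie (X : 𝔫) (c : C) : ⁅X, ι c⁆ = B X c • Z := hlie X (hmem c)
  have hB : Function.Injective B.flip := by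
    refine (injective_iff_map_eq_zero _).mpr fun c hc => ?_
    have hcent : ι c ∈ (LieAlgebra.center ℝ 𝔫).toSubmodule :=
      (LieModule.mem_maxTrivSubmodule ℝ 𝔫 𝔫 _).mpr fun X => by
        rw [hBlie, ← LinearMap.flip_apply, hc, LinearMap.zero_apply, zero_smul]
    rw [hcenter] at hcent
    obtain ⟨r, hr⟩ := Submodule.mem_span_singleton.mp hcent
    have hspan : (c : 𝔰.toSubmodule) ∈ Submodule.span ℝ {z} :=
      Submodule.mem_span_singleton.mpr ⟨r, Subtype.ext hr⟩
    exact Subtype.ext (Submodule.disjoint_def.mp hC.disjoint _ hspan c.2)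
  obtain ⟨X, hX⟩ := LinearMap.exists_dual_family_of_flip_injective hB b
  have hli : LinearIndependent ℝ (Fin.cons Z (fun i => ι (b i)) : Fin (n + 1) → 𝔫) := by
    have h : LinearIndependent ℝ (Fin.cons z (fun i => (b i : 𝔰.toSubmodule)) :
        Fin (n + 1) → 𝔰.toSubmodule) := by
      refine linearIndependent_finCons.mpr
        ⟨b.linearIndependent.map' C.subtype C.ker_subtype, fun hzC => hz ?_⟩
      refine Submodule.disjoint_def.mp hC.disjoint z (Submodule.mem_span_singleton_self z) ?_
      exact Submodule.span_le.mpr (Set.range_subset_iff.mpr fun i => (b i).2) hzC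
    have hcons : (Fin.cons Z (fun i => ι (b i)) : Fin (n + 1) → 𝔫) = 𝔰.toSubmodule.subtype ∘
        (Fin.cons z (fun i => (b i : 𝔰.toSubmodule)) : Fin (n + 1) → 𝔰.toSubmodule) := by
      funext i
      cases i using Fin.cases <;> rfl
    rw [hcons]
    exact h.map' 𝔰.toSubmodule.subtype 𝔰.toSubmodule.ker_subtype
  refine ⟨fun i => ι (b i), X, fun i => hmem (b i), hli, ?_, fun i => ?_, fun i j hij => ?_⟩
  · refine Submodule.eq_of_le_of_finrank_eq (Submodule.span_le.mpr ?_) ?_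
    · rintro _ ⟨i, rfl⟩
      cases i using Fin.cases with
      | zero => exact hZmem
      | succ i => exact hmem (b i)
    · rw [finrank_span_eq_card hli, Fintype.card_fin]
      exact hdim.symm
  · rw [hBlie, hX, if_pos rfl, one_smul]
  · rw [hBlie, hX, if_neg hij, zero_smul]
end

section
/- Let 𝔫 be a finite-dimensional real Lie algebra whose center is one-dimensional, spanned by a nonzero element Z, and let 𝔰 be an abelian Lie ideal of 𝔫 containing Z with ⁅X, Y⁆ ∈ ℝ·Z for all X ∈ 𝔫 and Y ∈ 𝔰. Then for any two linear functionals f, g : 𝔰 → ℝ with f(Z) = g(Z) ≠ 0 there exists X ∈ 𝔫 such that f(Y) = g(Y) + g(⁅X, Y⁆) for all Y ∈ 𝔰. -/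
/-- In finite dimension, a functional lies in the range of a map into the dual space as soon as it
vanishes on every vector annihilated by the whole range. -/
theorem Module.Dual.mem_range_of_forall_eq_zero {K V W : Type*} [Field K]
    [AddCommGroup V] [Module K V] [AddCommGroup W] [Module K W] [FiniteDimensional K W]
    (B : V →ₗ[K] Module.Dual K W) (φ : Module.Dual K W)
    (h : ∀ w, (∀ v, B v w = 0) → φ w = 0) : φ ∈ LinearMap.range B := by
  rw [← Subspace.dualCoannihilator_dualAnnihilator_eq (W := LinearMap.range B),
    Submodule.mem_dualAnnihilator]
  intro w hw
  rw [Submodule.mem_dualCoannihilator] at hw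
  exact h w fun v => hw _ (LinearMap.mem_range_self B v)

/-- Let `𝔫` be a finite-dimensional real Lie algebra whose center is
one-dimensional, spanned by `Z ≠ 0`, and `𝔰` an abelian Lie ideal containing `Z` with
`⁅X, Y⁆ ∈ ℝ·Z` for all `X ∈ 𝔫`, `Y ∈ 𝔰`.  Then for any linear functionals
`f, g : 𝔰 → ℝ` with `f(Z) = g(Z) ≠ 0` there is `X ∈ 𝔫` with
`f(Y) = g(Y) + g(⁅X, Y⁆)` for all `Y ∈ 𝔰`. -/
theorem coadjoint_transitivity_infinitesimal
    {𝔫 : Type*} [LieRing 𝔫] [LieAlgebra ℝ 𝔫] [FiniteDimensional ℝ 𝔫]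
    (Z : 𝔫) (hZ : Z ≠ 0)
    (hcenter : (LieAlgebra.center ℝ 𝔫).toSubmodule = Submodule.span ℝ {Z})
    (𝔰 : LieIdeal ℝ 𝔫)
    (habel : ∀ Y ∈ 𝔰, ∀ Y' ∈ 𝔰, ⁅Y, Y'⁆ = (0 : 𝔫))
    (hZmem : Z ∈ 𝔰)
    (hbrk : ∀ X : 𝔫, ∀ Y ∈ 𝔰, ∃ r : ℝ, ⁅X, Y⁆ = r • Z)
    (f g : 𝔰 →ₗ[ℝ] ℝ)
    (hfg : f ⟨Z, hZmem⟩ = g ⟨Z, hZmem⟩) (hgZ : g ⟨Z, hZmem⟩ ≠ 0) :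
    ∃ X : 𝔫, ∀ Y : 𝔰, f Y = g Y + g ⟨⁅X, (Y : 𝔫)⁆, 𝔰.lie_mem Y.2⟩ := by
  let B : 𝔫 →ₗ[ℝ] Module.Dual ℝ 𝔰 :=
    LinearMap.compRight ℝ g ∘ₗ (LieModule.toEnd ℝ 𝔫 𝔰 : 𝔫 →ₗ[ℝ] Module.End ℝ 𝔰)
  have hB (X : 𝔫) (Y : 𝔰) : B X Y = g ⟨⁅X, (Y : 𝔫)⁆, 𝔰.lie_mem Y.2⟩ := rfl
  obtain ⟨X, hX⟩ := Module.Dual.mem_range_of_forall_eq_zero B (f - g) fun Y hY => by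
    have hcentral : (Y : 𝔫) ∈ (LieAlgebra.center ℝ 𝔫).toSubmodule := by
      refine (LieModule.mem_maxTrivSubmodule ℝ 𝔫 𝔫 (Y : 𝔫)).2 fun X => ?_
      obtain ⟨r, hr⟩ := hbrk X Y Y.2
      have hrg : r * g ⟨Z, hZmem⟩ = 0 := by
        rw [← smul_eq_mul, ← map_smul, ← hY X, hB]
        exact congrArg g (Subtype.ext hr.symm)
      rw [hr, (mul_eq_zero.1 hrg).resolve_right hgZ, zero_smul]
    rw [hcenter, Submodule.mem_span_singleton] at hcentral
    obtain ⟨c, hc⟩ := hcentral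
    have hYZ : Y = c • (⟨Z, hZmem⟩ : 𝔰) := Subtype.ext hc.symm
    rw [hYZ, map_smul, LinearMap.sub_apply, hfg, sub_self, smul_zero]
  refine ⟨X, fun Y => ?_⟩
  rw [← hB, hX, LinearMap.sub_apply, add_sub_cancel]
end
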